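/- Fix a real number p ≥ 2 and a natural number m ≥ 2. Let u : ℝ^a → ℝ^n be an affine map u(x) = u₀ + A x with A ∘ A* = λ² id_{ℝ^n} for a constant λ ≥ 0 (u is totally geodesic and horizontally conformal with dilation λ). Then for every smooth map f : ℝ^n → ℝ^ℓ and every x, div(‖d_m(f∘u)‖^{p−2} σ_{m, f∘u})(x) = λ^{mp} · div(‖d_m f‖^{p−2} σ_{m,f})(u(x)). -/

import Mathlib

noncomputable section

open ContinuousLinearMap

/-- Euclidean space ℝ^n. -/
abbrev Euc (n : ℕ) : Type := EuclideanSpace ℝ (Fin n)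

/-- The `m`-th stress field `σ_{m,v}(x) = (Dv(x) ∘ Dv(x)*)^{m−1} ∘ Dv(x)`. -/
def mstress {a : ℕ} {F : Type*} [NormedAddCommGroup F] [InnerProductSpace ℝ F]
    [CompleteSpace F] (m : ℕ) (v : Euc a → F) (x : Euc a) : Euc a →L[ℝ] F :=
  (((fderiv ℝ v x) ∘L (ContinuousLinearMap.adjoint (fderiv ℝ v x))) ^ (m - 1)) ∘L
    (fderiv ℝ v x)

/-- Divergence of a field of linear maps: `div τ(x) = Σ_β D(y ↦ τ(y)(e_β))(x)(e_β)`. -/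
def divF {a : ℕ} {F : Type*} [NormedAddCommGroup F] [NormedSpace ℝ F]
    (τ : Euc a → (Euc a →L[ℝ] F)) (x : Euc a) : F :=
  ∑ β : Fin a, fderiv ℝ (fun y => τ y (EuclideanSpace.single β (1 : ℝ))) x
    (EuclideanSpace.single β (1 : ℝ))

/-- `‖d_m v‖²(x) = trace((Dv(x)* ∘ Dv(x))^m)`. -/
def dmNormSq {a : ℕ} {F : Type*} [NormedAddCommGroup F] [InnerProductSpace ℝ F]
    [CompleteSpace F] (m : ℕ) (v : Euc a → F) (x : Euc a) : ℝ :=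
  LinearMap.trace ℝ (Euc a)
    ((((ContinuousLinearMap.adjoint (fderiv ℝ v x)) ∘L (fderiv ℝ v x)) ^ m :
      Euc a →L[ℝ] Euc a) : Euc a →ₗ[ℝ] Euc a)

/-- The weighted `m`-th stress field `x ↦ ‖d_m v‖^{p−2}(x) σ_{m,v}(x)` (real exponent). -/
def wmStress {a : ℕ} {F : Type*} [NormedAddCommGroup F] [InnerProductSpace ℝ F]
    [CompleteSpace F] (p : ℝ) (m : ℕ) (v : Euc a → F) (x : Euc a) : Euc a →L[ℝ] F :=
  (Real.sqrt (dmNormSq m v x) ^ (p - 2)) • mstress m v x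

/-- `adjoint` is an `ℝ`-linear bounded map on real inner product spaces. -/
theorem isBoundedLinearMap_adjoint {E F : Type*} [NormedAddCommGroup E] [InnerProductSpace ℝ E]
    [CompleteSpace E] [NormedAddCommGroup F] [InnerProductSpace ℝ F] [CompleteSpace F] :
    IsBoundedLinearMap ℝ (fun L : E →L[ℝ] F => ContinuousLinearMap.adjoint L) where
  map_add L M := map_add _ L M
  map_smul c L := by simp
  bound := ⟨1, one_pos, fun L => by simp⟩

/-- A scalar function continuous at `x` times a function that vanishes and is differentiable at `x`
is differentiable at `x`. -/
theorem DifferentiableAt.continuousAt_smul_of_eq_zero {E F : Type*} [NormedAddCommGroup E]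
    [NormedSpace ℝ E] [NormedAddCommGroup F] [NormedSpace ℝ F] {g : E → ℝ} {h : E → F} {x : E}
    (hh : DifferentiableAt ℝ h x) (hg : ContinuousAt g x) (hx : h x = 0) :
    DifferentiableAt ℝ (fun y => g y • h y) x := by
  have key : HasFDerivAt (fun y => g y • h y) (g x • fderiv ℝ h x) x := by
    have h1 := hh.hasFDerivAt.isLittleO
    have h2 : (fun y => g y - g x) =o[nhds x] (fun _ => (1 : ℝ)) := by
      rw [Asymptotics.isLittleO_one_iff]
      simpa using hg.tendsto.sub_const (g x)
    have h3 : g =O[nhds x] (fun _ => (1 : ℝ)) := hg.isBigO_one ℝ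
    have h4 : (fun y => fderiv ℝ h x (y - x)) =O[nhds x] (fun y => y - x) :=
      (fderiv ℝ h x).isBigO_sub _ _
    have h5 := (h3.smul_isLittleO h1).add (h2.smul_isBigO h4)
    refine .of_isLittleO ?_
    refine (h5.congr_left fun y => ?_).trans_isBigO ?_
    · simp only [hx, FunLike.coe_smul, Pi.smul_apply, smul_zero]
      module
    · simpa using Asymptotics.isBigO_refl _ _
  exact key.differentiableAt

/-- A self-adjoint nilpotent operator vanishes. -/
theorem IsSelfAdjoint.eq_zero_of_pow_eq_zero {R : Type*} [NormedRing R] [StarRing R]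
    [CStarRing R] {P : R} (hP : IsSelfAdjoint P) {k : ℕ} (hk : P ^ k = 0) : P = 0 := by
  have h1 : P ^ 2 ^ k = 0 := pow_eq_zero_of_le Nat.lt_two_pow_self.le hk
  have h2 := hP.nnnorm_pow_two_pow k
  rw [h1, nnnorm_zero] at h2
  exact nnnorm_eq_zero.1 (pow_eq_zero_iff (by positivity) |>.1 h2.symm)

theorem trace_adjoint_comp_self {n : ℕ} {F : Type*} [NormedAddCommGroup F]
    [InnerProductSpace ℝ F] [CompleteSpace F] (M : Euc n →L[ℝ] F) :
    LinearMap.trace ℝ (Euc n)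
      ((ContinuousLinearMap.adjoint M ∘L M : Euc n →L[ℝ] Euc n) : Euc n →ₗ[ℝ] Euc n)
      = ∑ i, ‖M (EuclideanSpace.single i (1 : ℝ))‖ ^ 2 := by
  rw [LinearMap.trace_eq_sum_inner _ (EuclideanSpace.basisFun (Fin n) ℝ)]
  refine Finset.sum_congr rfl fun i _ => ?_
  simp [ContinuousLinearMap.adjoint_inner_right]

theorem trace_adjoint_comp_self_nonneg {n : ℕ} {F : Type*} [NormedAddCommGroup F]
    [InnerProductSpace ℝ F] [CompleteSpace F] (M : Euc n →L[ℝ] F) :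
    0 ≤ LinearMap.trace ℝ (Euc n)
      ((ContinuousLinearMap.adjoint M ∘L M : Euc n →L[ℝ] Euc n) : Euc n →ₗ[ℝ] Euc n) := by
  rw [trace_adjoint_comp_self]
  positivity

theorem eq_zero_of_trace_adjoint_comp_self {n : ℕ} {F : Type*} [NormedAddCommGroup F]
    [InnerProductSpace ℝ F] [CompleteSpace F] {M : Euc n →L[ℝ] F}
    (h : LinearMap.trace ℝ (Euc n)
      ((ContinuousLinearMap.adjoint M ∘L M : Euc n →L[ℝ] Euc n) : Euc n →ₗ[ℝ] Euc n) = 0) :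
    M = 0 := by
  rw [trace_adjoint_comp_self, Finset.sum_eq_zero_iff_of_nonneg fun _ _ => by positivity] at h
  have : (M : Euc n →ₗ[ℝ] F) = 0 := by
    refine (EuclideanSpace.basisFun (Fin n) ℝ).toBasis.ext fun i => ?_
    simpa using h i (Finset.mem_univ i)
  ext1 v
  simpa using LinearMap.congr_fun this v

/-- Positivity of `trace ((L* L)^m)` for `L ≠ 0`: the operator `(L* L)^m` is of the form `M* M`,
where `M` is `(L* L)^k` or `L (L* L)^k`. -/
theorem trace_adjoint_comp_self_pow_pos {n ℓ : ℕ} {L : Euc n →L[ℝ] Euc ℓ} (hL : L ≠ 0) (m : ℕ)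
    (hm : m ≠ 0) :
    0 < LinearMap.trace ℝ (Euc n)
      (((ContinuousLinearMap.adjoint L ∘L L) ^ m : Euc n →L[ℝ] Euc n) : Euc n →ₗ[ℝ] Euc n) := by
  set P : Euc n →L[ℝ] Euc n := ContinuousLinearMap.adjoint L ∘L L with hPdef
  have hP : IsSelfAdjoint P := by
    rw [ContinuousLinearMap.isSelfAdjoint_iff', hPdef, ContinuousLinearMap.adjoint_comp,
      ContinuousLinearMap.adjoint_adjoint]
  have hP0 : P ≠ 0 := fun h => hL <| eq_zero_of_trace_adjoint_comp_self (by rw [← hPdef, h]; simp)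
  have hadj (k : ℕ) : ContinuousLinearMap.adjoint (P ^ k) = P ^ k :=
    ContinuousLinearMap.isSelfAdjoint_iff'.1 (hP.pow k)
  obtain ⟨k, rfl | rfl⟩ := m.even_or_odd'
  · have h : P ^ (2 * k) = ContinuousLinearMap.adjoint (P ^ k) ∘L (P ^ k) := by
      rw [hadj, two_mul, pow_add]; rfl
    rw [h]
    refine (trace_adjoint_comp_self_nonneg _).lt_of_ne' fun h0 => hP0 ?_
    exact hP.eq_zero_of_pow_eq_zero (eq_zero_of_trace_adjoint_comp_self h0)
  · have h : P ^ (2 * k + 1) = ContinuousLinearMap.adjoint (L ∘L (P ^ k)) ∘L (L ∘L (P ^ k)) := by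
      rw [ContinuousLinearMap.adjoint_comp, hadj, two_mul, add_assoc, pow_add, pow_succ']; rfl
    rw [h]
    refine (trace_adjoint_comp_self_nonneg _).lt_of_ne' fun h0 => hP0 ?_
    refine hP.eq_zero_of_pow_eq_zero (k := k + 1) ?_
    have h1 := eq_zero_of_trace_adjoint_comp_self h0
    rw [pow_succ']
    change ContinuousLinearMap.adjoint L ∘L (L ∘L (P ^ k)) = 0
    rw [h1, ContinuousLinearMap.comp_zero]

theorem differentiable_mstress {n ℓ : ℕ} (m : ℕ) {f : Euc n → Euc ℓ}
    (hf : Differentiable ℝ (fderiv ℝ f)) : Differentiable ℝ (mstress m f) := by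
  have hadj : Differentiable ℝ fun z => ContinuousLinearMap.adjoint (fderiv ℝ f z) :=
    isBoundedLinearMap_adjoint.differentiable.comp hf
  exact ((hf.clm_comp hadj).pow (m - 1)).clm_comp hf

theorem differentiable_dmNormSq {n ℓ : ℕ} (m : ℕ) {f : Euc n → Euc ℓ}
    (hf : Differentiable ℝ (fderiv ℝ f)) : Differentiable ℝ (dmNormSq m f) := by
  have hadj : Differentiable ℝ fun z => ContinuousLinearMap.adjoint (fderiv ℝ f z) :=
    isBoundedLinearMap_adjoint.differentiable.comp hf
  have hpow : Differentiable ℝ fun z =>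
      ((ContinuousLinearMap.adjoint (fderiv ℝ f z)) ∘L (fderiv ℝ f z)) ^ m :=
    (hadj.clm_comp hf).pow m
  have htr : Differentiable ℝ fun T : Euc n →L[ℝ] Euc n =>
      LinearMap.trace ℝ (Euc n) (T : Euc n →ₗ[ℝ] Euc n) :=
    (LinearMap.toContinuousLinearMap
      (LinearMap.trace ℝ (Euc n) ∘ₗ ContinuousLinearMap.coeLM ℝ)).differentiable
  exact htr.comp hpow

/-- The weighted stress field of a smooth map is differentiable, also at the critical points. -/
theorem differentiable_wmStress {n ℓ : ℕ} {p : ℝ} (hp : 2 ≤ p) {m : ℕ} (hm : m ≠ 0)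
    {f : Euc n → Euc ℓ} (hf : Differentiable ℝ (fderiv ℝ f)) :
    Differentiable ℝ (wmStress p m f) := by
  intro z
  have hσ := differentiable_mstress m hf z
  have hN := differentiable_dmNormSq m hf
  by_cases hz : fderiv ℝ f z = 0
  · refine hσ.continuousAt_smul_of_eq_zero ?_ (by simp [mstress, hz])
    exact (hN.continuous.sqrt.rpow_const fun _ => Or.inr (sub_nonneg.2 hp)).continuousAt
  · have hpos : 0 < dmNormSq m f z := trace_adjoint_comp_self_pow_pos hz m hm
    exact (((hN z).sqrt hpos.ne').rpow_const (Or.inl (Real.sqrt_pos.2 hpos).ne')).smul hσ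

/-- The trace of a bilinear map pulled back along `A` with `A A* = c id` scales by `c`. -/
theorem sum_bilin_apply_of_comp_adjoint {a n : ℕ} {F : Type*} [NormedAddCommGroup F]
    [NormedSpace ℝ F] {A : Euc a →L[ℝ] Euc n} {c : ℝ}
    (hA : A ∘L (ContinuousLinearMap.adjoint A) = c • ContinuousLinearMap.id ℝ (Euc n))
    (B : Euc n →L[ℝ] Euc n →L[ℝ] F) :
    ∑ β, B (A (EuclideanSpace.single β (1 : ℝ))) (A (EuclideanSpace.single β (1 : ℝ)))
      = c • ∑ i, B (EuclideanSpace.single i (1 : ℝ)) (EuclideanSpace.single i (1 : ℝ)) := by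
  have hexp (v : Euc n) : v = ∑ i, v i • EuclideanSpace.single i (1 : ℝ) := by
    simpa using ((EuclideanSpace.basisFun (Fin n) ℝ).sum_repr v).symm
  have hcoord (i : Fin n) (β : Fin a) : A (EuclideanSpace.single β (1 : ℝ)) i
      = ContinuousLinearMap.adjoint A (EuclideanSpace.single i (1 : ℝ)) β := by
    have h := ContinuousLinearMap.adjoint_inner_left A (EuclideanSpace.single β (1 : ℝ))
      (EuclideanSpace.single i (1 : ℝ))
    simpa [EuclideanSpace.inner_single_left, EuclideanSpace.inner_single_right] using h.symm
  have hsum (i j : Fin n) : ∑ β, A (EuclideanSpace.single β (1 : ℝ)) i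
      * A (EuclideanSpace.single β (1 : ℝ)) j = if i = j then c else 0 := by
    have h := ContinuousLinearMap.adjoint_inner_left A
      (ContinuousLinearMap.adjoint A (EuclideanSpace.single j (1 : ℝ)))
      (EuclideanSpace.single i (1 : ℝ))
    have h' := congrArg (fun T => T (EuclideanSpace.single j (1 : ℝ))) hA
    simp only [ContinuousLinearMap.comp_apply] at h'
    rw [h'] at h
    simp only [hcoord]
    simpa [PiLp.inner_apply, Pi.single_apply, mul_comm] using h
  have hB (v : Euc n) : B v v = ∑ i, ∑ j, (v i * v j) •
      B (EuclideanSpace.single i (1 : ℝ)) (EuclideanSpace.single j (1 : ℝ)) := by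
    conv_lhs => rw [hexp v]
    simp only [map_sum, map_smul, sum_apply, smul_apply, Finset.smul_sum, smul_smul]
    rw [Finset.sum_comm]
    simp only [mul_comm]
  simp only [hB (A _)]
  rw [Finset.sum_comm, Finset.smul_sum]
  refine Finset.sum_congr rfl fun i _ => ?_
  rw [Finset.sum_comm]
  simp only [← Finset.sum_smul, hsum, ite_smul, zero_smul, Finset.sum_ite_eq, Finset.mem_univ,
    if_true]

section Horizontal

variable {a n ℓ : ℕ} {A : Euc a →L[ℝ] Euc n} {c : ℝ}

theorem comp_adjoint_comp_of_comp_adjoint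
    (hA : A ∘L (ContinuousLinearMap.adjoint A) = c • ContinuousLinearMap.id ℝ (Euc n))
    (L : Euc n →L[ℝ] Euc ℓ) :
    (L ∘L A) ∘L ContinuousLinearMap.adjoint (L ∘L A)
      = c • (L ∘L ContinuousLinearMap.adjoint L) := by
  rw [ContinuousLinearMap.adjoint_comp, ContinuousLinearMap.comp_assoc,
    ← ContinuousLinearMap.comp_assoc A, hA]
  ext1 v
  simp

theorem trace_adjoint_comp_self_pow_comm {E F : Type*} [NormedAddCommGroup E]
    [InnerProductSpace ℝ E] [FiniteDimensional ℝ E] [CompleteSpace E] [NormedAddCommGroup F]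
    [InnerProductSpace ℝ F] [FiniteDimensional ℝ F] [CompleteSpace F]
    (L : E →L[ℝ] F) {m : ℕ} (hm : m ≠ 0) :
    LinearMap.trace ℝ E
      (((ContinuousLinearMap.adjoint L ∘L L) ^ m : E →L[ℝ] E) : E →ₗ[ℝ] E)
    = LinearMap.trace ℝ F
      (((L ∘L ContinuousLinearMap.adjoint L) ^ m : F →L[ℝ] F) : F →ₗ[ℝ] F) := by
  obtain ⟨k, rfl⟩ := Nat.exists_eq_succ_of_ne_zero hm
  have hcomm : ∀ k : ℕ, L ∘L ((ContinuousLinearMap.adjoint L ∘L L) ^ k)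
      = ((L ∘L ContinuousLinearMap.adjoint L) ^ k) ∘L L := by
    intro k
    induction k with
    | zero => rfl
    | succ k ih =>
      rw [pow_succ, pow_succ]
      change (L ∘L ((ContinuousLinearMap.adjoint L ∘L L) ^ k)) ∘L _ = _
      rw [ih]
      rfl
  have h1 : (ContinuousLinearMap.adjoint L ∘L L) ^ (k + 1)
      = ContinuousLinearMap.adjoint L ∘L (((L ∘L ContinuousLinearMap.adjoint L) ^ k) ∘L L) := by
    rw [pow_succ', ← hcomm]; rfl
  have h2 : (L ∘L ContinuousLinearMap.adjoint L) ^ (k + 1)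
      = (((L ∘L ContinuousLinearMap.adjoint L) ^ k) ∘L L) ∘L ContinuousLinearMap.adjoint L := by
    rw [pow_succ]; rfl
  rw [Nat.succ_eq_add_one, h1, h2]
  exact LinearMap.trace_comp_comm' _ _

theorem dmNormSq_of_fderiv_eq_comp
    (hA : A ∘L (ContinuousLinearMap.adjoint A) = c • ContinuousLinearMap.id ℝ (Euc n))
    {m : ℕ} (hm : m ≠ 0) {g : Euc a → Euc ℓ} {f : Euc n → Euc ℓ} {x : Euc a} {z : Euc n}
    (hg : fderiv ℝ g x = fderiv ℝ f z ∘L A) : dmNormSq m g x = c ^ m * dmNormSq m f z := by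
  rw [dmNormSq, dmNormSq, trace_adjoint_comp_self_pow_comm _ hm,
    trace_adjoint_comp_self_pow_comm _ hm, hg, comp_adjoint_comp_of_comp_adjoint hA, smul_pow,
    ContinuousLinearMap.toLinearMap_smul, map_smul, smul_eq_mul]

theorem mstress_of_fderiv_eq_comp
    (hA : A ∘L (ContinuousLinearMap.adjoint A) = c • ContinuousLinearMap.id ℝ (Euc n))
    (m : ℕ) {g : Euc a → Euc ℓ} {f : Euc n → Euc ℓ} {x : Euc a} {z : Euc n}
    (hg : fderiv ℝ g x = fderiv ℝ f z ∘L A) :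
    mstress m g x = c ^ (m - 1) • (mstress m f z ∘L A) := by
  rw [mstress, mstress, hg, comp_adjoint_comp_of_comp_adjoint hA, smul_pow,
    ContinuousLinearMap.smul_comp, ContinuousLinearMap.comp_assoc]

end Horizontal

theorem wmStress_of_fderiv_eq_comp {a n ℓ : ℕ} {A : Euc a →L[ℝ] Euc n} {lam : ℝ}
    (hlam : 0 ≤ lam)
    (hA : A ∘L (ContinuousLinearMap.adjoint A)
      = (lam ^ 2) • ContinuousLinearMap.id ℝ (Euc n))
    (p : ℝ) {m : ℕ} (hm : m ≠ 0) {g : Euc a → Euc ℓ} {f : Euc n → Euc ℓ} {x : Euc a} {z : Euc n}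
    (hg : fderiv ℝ g x = fderiv ℝ f z ∘L A) :
    wmStress p m g x
      = ((lam ^ m) ^ (p - 2) * (lam ^ 2) ^ (m - 1)) • (wmStress p m f z ∘L A) := by
  have hsqrt : Real.sqrt (dmNormSq m g x) = lam ^ m * Real.sqrt (dmNormSq m f z) := by
    rw [dmNormSq_of_fderiv_eq_comp hA hm hg, Real.sqrt_mul (by positivity), ← pow_mul, mul_comm 2,
      pow_mul, Real.sqrt_sq (by positivity)]
  rw [wmStress, wmStress, hsqrt, mstress_of_fderiv_eq_comp hA m hg,
    Real.mul_rpow (by positivity) (Real.sqrt_nonneg _), ContinuousLinearMap.smul_comp, smul_smul,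
    smul_smul]
  congr 1
  ring

/-- for `p ≥ 2`, `m ≥ 2`, and `u(x) = u₀ + A x` affine with `A ∘ A* = λ² id`
(totally geodesic and horizontally conformal with dilation `λ ≥ 0`), for every smooth
`f : ℝ^n → ℝ^ℓ` and every `x`,
`div(‖d_m(f∘u)‖^{p−2} σ_{m,f∘u})(x) = λ^{mp} · div(‖d_m f‖^{p−2} σ_{m,f})(u(x))`. -/
theorem stmt11 {a n ℓ : ℕ} (p : ℝ) (hp : 2 ≤ p) (m : ℕ) (hm : 2 ≤ m)
    (u₀ : Euc n) (A : Euc a →L[ℝ] Euc n) (lam : ℝ) (hlam : 0 ≤ lam)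
    (hA : A ∘L (ContinuousLinearMap.adjoint A)
      = (lam ^ 2) • ContinuousLinearMap.id ℝ (Euc n))
    (u : Euc a → Euc n) (hu : ∀ x, u x = u₀ + A x)
    (f : Euc n → Euc ℓ) (hf : ContDiff ℝ (⊤ : ℕ∞) f) (x : Euc a) :
    divF (wmStress p m (f ∘ u)) x
      = (lam ^ ((m : ℝ) * p)) • divF (wmStress p m f) (u x) := by
  have hm0 : m ≠ 0 := by omega
  have hfd : Differentiable ℝ f := hf.differentiable (by simp)
  have hf' : Differentiable ℝ (fderiv ℝ f) :=
    (hf.fderiv_right (m := 1) (by norm_cast)).differentiable one_ne_zero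
  have hud (y : Euc a) : HasFDerivAt u A y := by
    rw [funext hu]
    exact A.hasFDerivAt.const_add u₀
  have hT := differentiable_wmStress hp hm0 hf'
  have hchain (y : Euc a) : fderiv ℝ (f ∘ u) y = fderiv ℝ f (u y) ∘L A :=
    ((hfd (u y)).hasFDerivAt.comp y (hud y)).fderiv
  set c : ℝ := (lam ^ m) ^ (p - 2) * (lam ^ 2) ^ (m - 1) with hc
  have hw (y : Euc a) : wmStress p m (f ∘ u) y = c • (wmStress p m f (u y) ∘L A) :=
    wmStress_of_fderiv_eq_comp hlam hA p hm0 (hchain y)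
  set D := fderiv ℝ (wmStress p m f) (u x) with hD
  have hleft (v : Euc a) : fderiv ℝ (fun y => wmStress p m (f ∘ u) y v) x v
      = c • D (A v) (A v) := by
    have h1 : HasFDerivAt (fun y => wmStress p m f (u y)) (D ∘L A) x :=
      (hT (u x)).hasFDerivAt.comp x (hud x)
    have h2 := (h1.clm_apply (hasFDerivAt_const (A v) x)).const_smul c
    simp only [hw]
    refine (congrArg (fun T => T v) h2.fderiv).trans ?_
    simp
  have hright (v : Euc n) : fderiv ℝ (fun z => wmStress p m f z v) (u x) v = D v v := by
    have h2 := (hT (u x)).hasFDerivAt.clm_apply (hasFDerivAt_const v (u x))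
    rw [h2.fderiv]
    simp [hD]
  have hpow : c * lam ^ 2 = lam ^ ((m : ℝ) * p) := by
    have h1 : (lam ^ m) ^ (p - 2) = lam ^ ((m : ℝ) * (p - 2)) := by
      rw [← Real.rpow_natCast, ← Real.rpow_mul hlam]
    have h2 : (lam ^ 2) ^ (m - 1) * lam ^ 2 = lam ^ ((m : ℝ) * 2) := by
      rw [← pow_succ, Nat.sub_add_cancel (by omega), ← pow_mul, mul_comm 2, ← Real.rpow_natCast]
      push_cast
      rfl
    rw [hc, mul_assoc, h1, h2, ← Real.rpow_add_of_nonneg hlam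
      (mul_nonneg m.cast_nonneg (sub_nonneg.2 hp)) (by positivity)]
    congr 1
    ring
  simp only [divF, hleft, hright]
  rw [← Finset.smul_sum, sum_bilin_apply_of_comp_adjoint hA D, smul_smul, hpow]
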